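/- Fix i ≥ 1 and let k = 2^i. Let α_1,…,α_{k−1} be the entries of the i-th order silver stepsize schedule s̄_i, and let A_k = Σ_{j=1}^{k−1} α_j. Let f: ℝ^d → ℝ be convex, differentiable with 1-Lipschitz gradient, and possess a minimizer. Fix x_0, set g_0 = ∇f(x_0), and suppose α is a real with α ≥ (√2−1)A_k + √2; set x_1 = x_0 − α g_0 and x_{j+1} = x_j − α_j ∇f(x_j) for 1 ≤ j ≤ k−1. Then for every ℓ with 1 ≤ ℓ ≤ k−1, f(x_ℓ) − f(x_0) ≤ 432·α²·‖g_0‖². -/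

import Mathlib

open Finset
open scoped RealInnerProductSpace

noncomputable section

/-- Gradient-descent trajectory along a finite list of stepsizes. -/
def gdIter {E : Type*} [AddCommGroup E] [SMul ℝ E] (g : E → E) : E → List ℝ → E
  | x, [] => x
  | x, a :: L => gdIter g (x - a • g x) L

/-- A finite stepsize schedule (of positive reals) is primitive if the key
gradient-descent inequality holds for every smooth convex problem instance. -/
def IsPrimitive (L : List ℝ) : Prop :=
  (∀ a ∈ L, (0:ℝ) < a) ∧
  ∀ (d : ℕ) (f : EuclideanSpace ℝ (Fin d) → ℝ)
    (g : EuclideanSpace ℝ (Fin d) → EuclideanSpace ℝ (Fin d)),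
    ConvexOn ℝ Set.univ f →
    (∀ y, HasGradientAt f (g y) y) →
    LipschitzWith 1 g →
    ∀ xstar : EuclideanSpace ℝ (Fin d), IsMinOn f Set.univ xstar →
    ∀ x1 : EuclideanSpace ℝ (Fin d),
      L.sum * (f (gdIter g x1 L) - f xstar)
        + (L.sum * (L.sum + 1) / 2) * ‖g (gdIter g x1 L)‖ ^ 2
        + 2⁻¹ * ‖gdIter g x1 L - xstar‖ ^ 2
      ≤ 2⁻¹ * ‖x1 - xstar‖ ^ 2
        + ∑ i : Fin L.length,
            L.get i *
              (f (gdIter g x1 (L.take i.1)) - f xstar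
                - ⟪g (gdIter g x1 (L.take i.1)), gdIter g x1 (L.take i.1) - xstar⟫
                + 2⁻¹ * ‖g (gdIter g x1 (L.take i.1))‖ ^ 2)

/-- The join-stepsize function. -/
def phi (x y : ℝ) : ℝ :=
  (-(x + y) + Real.sqrt ((x + y + 2) ^ 2 + 4 * (x + 1) * (y + 1))) / 2

/-- Concatenation of two stepsize schedules with the join stepsize in between. -/
def concatSched (s r : List ℝ) : List ℝ := s ++ phi s.sum r.sum :: r

/-- The silver stepsize schedules. -/
def silver : ℕ → List ℝ
  | 0 => []
  | i + 1 => concatSched (silver i) (silver i)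

/-- Recursive concatenation of a sequence of schedules. -/
def concatAll (s : ℕ → List ℝ) : ℕ → List ℝ
  | 0 => []
  | i + 1 => concatSched (concatAll s i) (s (i + 1))

/-- The number of copies of the `j`-th silver schedule. -/
def kSeq (c : ℝ) (j : ℕ) : ℕ := ⌊2 * (2:ℝ) ^ (c * j)⌋₊

def MSeq (c : ℝ) (j : ℕ) : ℕ := ∑ j' ∈ Finset.Icc 1 j, kSeq c j'

/-- The block index `j` of `i`, i.e. the `j` with `M_{j-1} < i ≤ M_j`. -/
def blockIdx (c : ℝ) (i : ℕ) : ℕ := sInf {j | i ≤ MSeq c j}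

/-- The partially concatenated schedules `ŝ_i`. -/
def shatSched (c : ℝ) : ℕ → List ℝ := concatAll fun i => silver (blockIdx c i)

/-- The `t`-th entry (1-indexed) of the infinite limiting schedule `ŝ`. -/
def shatEntry (c : ℝ) (t : ℕ) : ℝ := (shatSched c t).getD (t - 1) 0

section SmoothConvex

variable {E : Type*} [NormedAddCommGroup E] [InnerProductSpace ℝ E]

/-- The interpolation inequality satisfied by a convex function `f` with `1`-Lipschitz gradient
`g`. -/
def Interpolates (f : E → ℝ) (g : E → E) : Prop :=
  ∀ x y, f x + ⟪g x, y - x⟫ + 2⁻¹ * ‖g y - g x‖ ^ 2 ≤ f y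

theorem hasDerivAt_comp_line [CompleteSpace E] {f : E → ℝ} {g : E → E}
    (hgrad : ∀ y, HasGradientAt f (g y) y) (x v : E) (t : ℝ) :
    HasDerivAt (fun s : ℝ => f (x + s • v)) ⟪g (x + t • v), v⟫ t := by
  have h1 : HasDerivAt (fun s : ℝ => x + s • v) v t := by
    simpa using ((hasDerivAt_id t).smul_const v).const_add x
  have h2 := (hgrad (x + t • v)).hasFDerivAt.comp_hasDerivAt t h1
  simpa [Function.comp_def] using h2

theorem add_inner_le_of_convexOn [CompleteSpace E] {f : E → ℝ} {g : E → E}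
    (hconv : ConvexOn ℝ Set.univ f) (hgrad : ∀ y, HasGradientAt f (g y) y) (x y : E) :
    f x + ⟪g x, y - x⟫ ≤ f y := by
  have hc : ConvexOn ℝ Set.univ (fun s : ℝ => f (x + s • (y - x))) := by
    refine ⟨convex_univ, fun a _ b _ p q hp hq hpq => ?_⟩
    have h := hconv.2 (Set.mem_univ (x + a • (y - x))) (Set.mem_univ (x + b • (y - x))) hp hq hpq
    have e : x + (p • a + q • b) • (y - x)
        = p • (x + a • (y - x)) + q • (x + b • (y - x)) := by
      obtain rfl : q = 1 - p := by linarith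
      simp only [smul_eq_mul]
      module
    simpa only [e] using h
  have hd := hasDerivAt_comp_line hgrad x (y - x) 0
  have h := hc.le_slope_of_hasDerivAt (Set.mem_univ 0) (Set.mem_univ 1) one_pos hd
  simp [slope_def_field] at h
  linarith

theorem le_add_inner_add_of_lipschitzWith [CompleteSpace E] {f : E → ℝ} {g : E → E}
    (hgrad : ∀ y, HasGradientAt f (g y) y) (hlip : LipschitzWith 1 g) (x v : E) :
    f (x + v) ≤ f x + ⟪g x, v⟫ + 2⁻¹ * ‖v‖ ^ 2 := by
  have hd : ∀ t : ℝ, HasDerivAt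
      (fun s : ℝ => f (x + s • v) - s * ⟪g x, v⟫ - s ^ 2 * (2⁻¹ * ‖v‖ ^ 2))
      (⟪g (x + t • v), v⟫ - ⟪g x, v⟫ - t * ‖v‖ ^ 2) t := by
    intro t
    have h := ((hasDerivAt_comp_line hgrad x v t).sub
      ((hasDerivAt_id t).mul_const ⟪g x, v⟫)).sub
      ((hasDerivAt_pow 2 t).mul_const (2⁻¹ * ‖v‖ ^ 2))
    refine h.congr_deriv ?_
    simp
    ring
  have hanti : AntitoneOn
      (fun s : ℝ => f (x + s • v) - s * ⟪g x, v⟫ - s ^ 2 * (2⁻¹ * ‖v‖ ^ 2)) (Set.Icc 0 1) := by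
    refine antitoneOn_of_deriv_nonpos (convex_Icc 0 1)
      (fun t _ => (hd t).continuousAt.continuousWithinAt)
      (fun t _ => (hd t).differentiableAt.differentiableWithinAt) fun t ht => ?_
    rw [interior_Icc] at ht
    rw [(hd t).deriv, ← inner_sub_left]
    have h1 := real_inner_le_norm (g (x + t • v) - g x) v
    have h2 := hlip.dist_le_mul (x + t • v) x
    rw [dist_eq_norm, dist_eq_norm, add_sub_cancel_left, norm_smul, Real.norm_eq_abs,
      abs_of_pos ht.1, NNReal.coe_one, one_mul] at h2
    nlinarith [mul_le_mul_of_nonneg_right h2 (norm_nonneg v)]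
  have h := hanti (Set.left_mem_Icc.2 zero_le_one) (Set.right_mem_Icc.2 zero_le_one) zero_le_one
  simp at h
  linarith

theorem interpolates_of_convexOn [CompleteSpace E] {f : E → ℝ} {g : E → E}
    (hconv : ConvexOn ℝ Set.univ f) (hgrad : ∀ y, HasGradientAt f (g y) y)
    (hlip : LipschitzWith 1 g) : Interpolates f g := by
  intro x y
  have h1 := le_add_inner_add_of_lipschitzWith hgrad hlip y (-(g y - g x))
  have h2 := add_inner_le_of_convexOn hconv hgrad x (y + -(g y - g x))
  have e : y + -(g y - g x) - x = (y - x) - (g y - g x) := by abel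
  have h3 : ⟪g y, g y - g x⟫ - ⟪g x, g y - g x⟫ = ‖g y - g x‖ ^ 2 := by
    rw [← inner_sub_left, real_inner_self_eq_norm_sq]
  rw [e, inner_sub_right] at h2
  rw [inner_neg_right, norm_neg] at h1
  linarith

theorem gdIter_append (g : E → E) (x : E) (s r : List ℝ) :
    gdIter g x (s ++ r) = gdIter g (gdIter g x s) r := by
  induction s generalizing x with
  | nil => rfl
  | cons a s ih => exact ih _

/-- The weighted sum of function values and squared gradient norms along a trajectory that upper
bounds the final values of a balanced schedule. -/
def trajectorySum (f : E → ℝ) (g : E → E) : E → List ℝ → ℝ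
  | _, [] => 0
  | x, a :: L =>
    a * f x + (a - a ^ 2) / 2 * ‖g x‖ ^ 2 + trajectorySum f g (x - a • g x) L

theorem trajectorySum_append (f : E → ℝ) (g : E → E) (x : E) (s r : List ℝ) :
    trajectorySum f g x (s ++ r)
      = trajectorySum f g x s + trajectorySum f g (gdIter g x s) r := by
  induction s generalizing x with
  | nil => simp [trajectorySum, gdIter]
  | cons a s ih => simp [trajectorySum, gdIter, ih, add_assoc]

theorem trajectorySum_le {f : E → ℝ} {g : E → E} (hfg : Interpolates f g) {L : List ℝ}
    (hL : ∀ a ∈ L, 0 ≤ a) (x p : E) :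
    trajectorySum f g x L ≤ L.sum * f p + 2⁻¹ * ‖x - p‖ ^ 2 - 2⁻¹ * ‖gdIter g x L - p‖ ^ 2
      + ⟪x - gdIter g x L, g p⟫ - L.sum / 2 * ‖g p‖ ^ 2 := by
  induction L generalizing x with
  | nil => simp [trajectorySum, gdIter]
  | cons a L ih =>
    have h1 := ih (fun b hb => hL b (List.mem_cons_of_mem _ hb)) (x - a • g x)
    have h2 := mul_le_mul_of_nonneg_left (hfg x p) (hL a List.mem_cons_self)
    have e1 : ‖x - a • g x - p‖ ^ 2 = ‖x - p‖ ^ 2 + 2 * a * ⟪g x, p - x⟫ + a ^ 2 * ‖g x‖ ^ 2 := by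
      rw [show x - a • g x - p = (x - p) - a • g x by abel, norm_sub_sq_real, norm_smul,
        real_inner_smul_right, mul_pow, Real.norm_eq_abs, sq_abs, ← neg_sub p x, inner_neg_left,
        real_inner_comm]
      ring
    have e2 : ⟪x - a • g x - gdIter g (x - a • g x) L, g p⟫
        = ⟪x - gdIter g (x - a • g x) L, g p⟫ - a * ⟪g p, g x⟫ := by
      rw [sub_right_comm, inner_sub_left, real_inner_smul_left, real_inner_comm (g p) (g x)]
    rw [e1, e2] at h1
    rw [norm_sub_sq_real] at h2
    simp only [trajectorySum, gdIter, List.sum_cons]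
    linarith

/-- A schedule is balanced for `f` if its final function value and gradient norm are controlled by
the weighted sum along the trajectory. -/
def IsBalancedSchedule (f : E → ℝ) (g : E → E) (L : List ℝ) : Prop :=
  ∀ x, L.sum * f (gdIter g x L) + L.sum * (L.sum + 1) / 2 * ‖g (gdIter g x L)‖ ^ 2
    ≤ trajectorySum f g x L

theorem phi_sq {x y : ℝ} (hx : 0 ≤ x) (hy : 0 ≤ y) :
    phi x y ^ 2 + phi x y * (x + y) = x * y + 2 * x + 2 * y + 2 := by
  have h := Real.sq_sqrt (show 0 ≤ (x + y + 2) ^ 2 + 4 * (x + 1) * (y + 1) by positivity)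
  unfold phi
  linear_combination h / 4

theorem one_le_phi {x y : ℝ} (hx : 0 ≤ x) (hy : 0 ≤ y) : 1 ≤ phi x y := by
  have h : x + y + 2 ≤ √((x + y + 2) ^ 2 + 4 * (x + 1) * (y + 1)) :=
    Real.le_sqrt_of_sq_le (by nlinarith [mul_nonneg hx hy])
  unfold phi
  linarith

theorem phi_lt_add_two {x y : ℝ} (hx : 0 ≤ x) (hy : 0 ≤ y) : phi x y < y + 2 := by
  have h : √((x + y + 2) ^ 2 + 4 * (x + 1) * (y + 1)) < x + 3 * y + 4 := by
    rw [Real.sqrt_lt' (by positivity)]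
    nlinarith [mul_nonneg hx hy]
  unfold phi
  linarith

theorem IsBalancedSchedule.concatSched {f : E → ℝ} {g : E → E} (hfg : Interpolates f g) {s r : List ℝ}
    (hs0 : 0 ≤ s.sum) (hr0 : ∀ a ∈ r, 0 ≤ a) (hs : IsBalancedSchedule f g s) (hr : IsBalancedSchedule f g r) :
    IsBalancedSchedule f g (concatSched s r) := by
  intro x
  have hB : 0 ≤ r.sum := List.sum_nonneg hr0
  have hq := phi_sq hs0 hB
  have h1φ := one_le_phi hs0 hB
  have hφ := phi_lt_add_two hs0 hB
  simp only [_root_.concatSched, List.sum_append, List.sum_cons, gdIter_append,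
    trajectorySum_append, gdIter, trajectorySum]
  have hs1 := hs x
  generalize s.sum = A at *
  generalize hφe : phi A r.sum = φ at *
  generalize gdIter g x s = y at *
  have hr1 := hr (y - φ • g y)
  have hn := (hr (y - φ • g y)).trans (trajectorySum_le hfg hr0 _ y)
  have hN := (hr (y - φ • g y)).trans
    (trajectorySum_le hfg hr0 _ (gdIter g (y - φ • g y) r))
  generalize gdIter g (y - φ • g y) r = z at *
  have hzy := hfg z y
  have hyz := hfg y z
  obtain ⟨G, rfl⟩ : ∃ G, z = y - φ • g y - G := ⟨y - φ • g y - z, by abel⟩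
  generalize hw : g (y - φ • g y - G) = w at *
  generalize f (y - φ • g y - G) = fz at *
  generalize r.sum = B at *
  generalize g y = u at *
  rw [show y - φ • u - y = -(φ • u) by abel, show y - φ • u - G - y = -(φ • u + G) by abel,
    show y - φ • u - (y - φ • u - G) = G by abel, norm_neg, norm_neg, norm_add_sq_real,
    norm_smul, real_inner_smul_left, mul_pow, Real.norm_eq_abs, sq_abs] at hn
  rw [show y - φ • u - (y - φ • u - G) = G by abel, sub_self, norm_zero] at hN
  rw [show y - (y - φ • u - G) = φ • u + G by abel, inner_add_right, real_inner_smul_right,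
    norm_sub_sq_real] at hzy
  rw [show y - φ • u - G - y = -(φ • u + G) by abel, inner_neg_right, inner_add_right,
    real_inner_smul_right, real_inner_self_eq_norm_sq, norm_sub_sq_real] at hyz
  rw [real_inner_comm u G] at hn
  rw [real_inner_comm w G] at hN
  rw [real_inner_comm w u] at hzy
  have hpos : 0 < B + 2 - φ := by linarith
  have key : fz - f y + (A + 2 * B + φ + 1) / 2 * ‖w‖ ^ 2 - (A + 1 - φ) / 2 * ‖u‖ ^ 2 ≤ 0 := by
    refine nonpos_of_mul_nonpos_right ?_ hpos
    have h3 := mul_le_mul_of_nonneg_left hyz (sub_nonneg.2 h1φ)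
    linear_combination hn + hN + hzy + h3 + (‖u‖ ^ 2 / 2 - ‖w‖ ^ 2 / 2) * hq
  have := mul_nonpos_of_nonneg_of_nonpos (show 0 ≤ A + φ by linarith) key
  nlinarith

theorem phi_self {x : ℝ} (hx : 0 ≤ x) : phi x x = 1 + (√2 - 1) * (x + 1) := by
  have h : √((x + x + 2) ^ 2 + 4 * (x + 1) * (x + 1)) = 2 * √2 * (x + 1) := by
    rw [Real.sqrt_eq_iff_mul_self_eq (by positivity) (by positivity)]
    linear_combination -4 * (x + 1) ^ 2 * Real.sq_sqrt (show (0 : ℝ) ≤ 2 by norm_num)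
  rw [phi, h]
  ring

theorem silver_sum (i : ℕ) : (silver i).sum = (1 + √2) ^ i - 1 := by
  induction i with
  | zero => simp [silver]
  | succ i ih =>
    have h : 1 ≤ (1 + √2) ^ i := one_le_pow₀ (by linarith [Real.sqrt_nonneg 2])
    simp only [silver, concatSched, List.sum_append, List.sum_cons]
    rw [phi_self (by linarith), ih]
    ring

theorem silver_sum_nonneg (i : ℕ) : 0 ≤ (silver i).sum := by
  have h : 1 ≤ (1 + √2) ^ i := one_le_pow₀ (by linarith [Real.sqrt_nonneg 2])
  linarith [silver_sum i]

theorem silver_nonneg (i : ℕ) : ∀ a ∈ silver i, 0 ≤ a := by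
  induction i with
  | zero => simp [silver]
  | succ i ih =>
    have h := one_le_phi (silver_sum_nonneg i) (silver_sum_nonneg i)
    intro a ha
    simp only [silver, concatSched, List.mem_append, List.mem_cons] at ha
    rcases ha with ha | rfl | ha
    · exact ih a ha
    · linarith
    · exact ih a ha

theorem silver_length (i : ℕ) : (silver i).length = 2 ^ i - 1 := by
  induction i with
  | zero => simp [silver]
  | succ i ih =>
    have h := Nat.one_le_two_pow (n := i)
    simp only [silver, concatSched, List.length_append, List.length_cons, ih, pow_succ]
    omega

theorem isBalancedSchedule_silver {f : E → ℝ} {g : E → E} (hfg : Interpolates f g) (i : ℕ) :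
    IsBalancedSchedule f g (silver i) := by
  induction i with
  | zero => intro x; simp [silver, trajectorySum]
  | succ i ih => exact ih.concatSched hfg (silver_sum_nonneg i) (silver_nonneg i) ih

theorem sub_le_of_step {f : E → ℝ} {g : E → E} (hfg : Interpolates f g) (x : E) {α : ℝ}
    (hα : 0 ≤ α) : f (x - α • g x) - f x ≤ 2⁻¹ * α ^ 2 * ‖g x‖ ^ 2 := by
  have h := hfg (x - α • g x) x
  generalize g (x - α • g x) = w at *
  rw [sub_sub_cancel, real_inner_smul_right, norm_sub_sq_real, real_inner_comm] at h
  have h1 : 0 ≤ ‖α • g x + (w - g x)‖ ^ 2 := sq_nonneg _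
  have h2 : 0 ≤ ‖g x‖ ^ 2 := sq_nonneg _
  rw [norm_add_sq_real, norm_smul, mul_pow, Real.norm_eq_abs, sq_abs, real_inner_smul_left,
    inner_sub_right, norm_sub_sq_real, real_inner_self_eq_norm_sq, real_inner_comm (g x) w] at h1
  nlinarith [mul_nonneg hα h2]

theorem IsBalancedSchedule.bound_of_step {f : E → ℝ} {g : E → E} (hfg : Interpolates f g)
    {L : List ℝ} (hL0 : ∀ a ∈ L, 0 ≤ a) (hL : IsBalancedSchedule f g L) (x : E) (α : ℝ) :
    L.sum * (f (gdIter g (x - α • g x) L) - f x)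
        + L.sum * (L.sum + 1) / 2 * ‖g (gdIter g (x - α • g x) L)‖ ^ 2
        + 2⁻¹ * ‖x - gdIter g (x - α • g x) L‖ ^ 2
      ≤ (α ^ 2 - 2 * α - L.sum) / 2 * ‖g x‖ ^ 2
        + ⟪x - gdIter g (x - α • g x) L, g x⟫ := by
  have h := (hL (x - α • g x)).trans (trajectorySum_le hfg hL0 _ x)
  generalize gdIter g (x - α • g x) L = z at *
  rw [sub_sub_cancel_left, norm_neg, norm_smul, mul_pow, Real.norm_eq_abs, sq_abs,
    sub_right_comm, inner_sub_left, real_inner_smul_left, real_inner_self_eq_norm_sq,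
    norm_sub_rev z] at h
  linarith

theorem IsBalancedSchedule.sub_le_of_step {f : E → ℝ} {g : E → E} (hfg : Interpolates f g)
    {L : List ℝ} (hL0 : ∀ a ∈ L, 0 ≤ a) (hL : IsBalancedSchedule f g L) (x : E) {α : ℝ}
    (hα : 1 ≤ α) :
    L.sum * (f (gdIter g (x - α • g x) L) - f x) ≤ 2⁻¹ * α ^ 2 * ‖g x‖ ^ 2 := by
  have h := hL.bound_of_step hfg hL0 x α
  have hA : 0 ≤ L.sum := List.sum_nonneg hL0
  generalize gdIter g (x - α • g x) L = z at *
  have h1 : 0 ≤ ‖(x - z) - g x‖ ^ 2 := sq_nonneg _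
  rw [norm_sub_sq_real] at h1
  have h2 : 0 ≤ L.sum * (L.sum + 1) / 2 * ‖g z‖ ^ 2 := by positivity
  nlinarith [sq_nonneg ‖g x‖]

theorem IsBalancedSchedule.norm_sq_le_of_step {f : E → ℝ} {g : E → E} (hfg : Interpolates f g)
    {L : List ℝ} (hL0 : ∀ a ∈ L, 0 ≤ a) (hL : IsBalancedSchedule f g L) (x : E) {α : ℝ}
    (hα : L.sum + 1 ≤ α) :
    L.sum * (L.sum + 1) * ‖g (gdIter g (x - α • g x) L)‖ ^ 2 ≤ 2 * α ^ 2 * ‖g x‖ ^ 2 := by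
  have h := hL.bound_of_step hfg hL0 x α
  have hA : 0 ≤ L.sum := List.sum_nonneg hL0
  generalize gdIter g (x - α • g x) L = z at *
  generalize L.sum = A at *
  have h1 : 0 ≤ ‖(x - z) - (A + 1) • g x‖ ^ 2 := sq_nonneg _
  rw [norm_sub_sq_real, norm_smul, mul_pow, Real.norm_eq_abs, sq_abs,
    real_inner_smul_right] at h1
  have h2 := mul_le_mul_of_nonneg_left (hfg x z) hA
  rw [← neg_sub x z, inner_neg_right, real_inner_comm] at h2
  have h3 : 0 ≤ A * ‖g z - g x‖ ^ 2 := by positivity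
  have h4 : (α ^ 2 - 2 * α - A + (A + 1) ^ 2) * ‖g x‖ ^ 2 ≤ 2 * α ^ 2 * ‖g x‖ ^ 2 := by
    refine mul_le_mul_of_nonneg_right ?_ (sq_nonneg _)
    nlinarith
  linarith

theorem gdIter_silver_sub_le {f : E → ℝ} {g : E → E} (hfg : Interpolates f g) (i : ℕ) (x : E)
    {α : ℝ} (hα : 1 + (√2 - 1) * (1 + √2) ^ i ≤ α) (t : ℕ)
    (ht : t = 0 ∨ t < (silver i).length) :
    f (gdIter g (x - α • g x) ((silver i).take t)) - f x ≤ 2 * α ^ 2 * ‖g x‖ ^ 2 := by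
  have hs2 := Real.sq_sqrt (show (0 : ℝ) ≤ 2 by norm_num)
  have hlo : (1.41421 : ℝ) < √2 := Real.lt_sqrt_of_sq_lt (by norm_num)
  have hhi : √2 < (1.41422 : ℝ) := by rw [Real.sqrt_lt'] <;> norm_num
  induction i generalizing x α t with
  | zero =>
    obtain rfl : t = 0 := by simpa [silver] using ht
    have h := sub_le_of_step hfg x (α := α) (by norm_num at hα; linarith)
    simp only [List.take_zero, gdIter]
    nlinarith [mul_nonneg (sq_nonneg α) (sq_nonneg ‖g x‖)]
  | succ i ih =>
    have ha1 : 1 ≤ (1 + √2) ^ i := one_le_pow₀ (by linarith)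
    have hsum := silver_sum i
    have hα1 : 1 + (1 + √2) ^ i ≤ α := by
      refine le_of_eq_of_le ?_ hα
      rw [pow_succ]
      linear_combination -(1 + √2) ^ i * hs2
    have hα2 : 1 + (√2 - 1) * (1 + √2) ^ i ≤ α := by nlinarith
    simp only [silver, concatSched] at ht ⊢
    rcases eq_or_ne t 0 with rfl | ht0
    · simpa using ih x hα2 0 (Or.inl rfl)
    rcases lt_or_ge t (silver i).length with hlt | hge
    · rw [List.take_append_of_le_length hlt.le]
      exact ih x hα2 t (Or.inr hlt)
    have hi : i ≠ 0 := by
      rintro rfl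
      simp [silver] at ht
      omega
    have hf := (isBalancedSchedule_silver hfg i).sub_le_of_step hfg (silver_nonneg i) x
      (α := α) (by linarith)
    have hg := (isBalancedSchedule_silver hfg i).norm_sq_le_of_step hfg (silver_nonneg i) x
      (α := α) (by linarith)
    have hw : 0 ≤ α ^ 2 * ‖g x‖ ^ 2 := by positivity
    have hA : 1.41421 ≤ (silver i).sum := by
      have := le_self_pow₀ (show 1 ≤ 1 + √2 by linarith) hi
      linarith
    rcases hge.eq_or_lt with rfl | hgt
    · rw [List.take_left]
      generalize gdIter g (x - α • g x) (silver i) = y at *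
      nlinarith
    obtain ⟨k, rfl⟩ := Nat.exists_eq_add_of_lt hgt
    rw [add_assoc, List.take_length_add_append, List.take_succ_cons, gdIter_append]
    simp only [gdIter]
    have hk : k < (silver i).length := by simp at ht; omega
    rw [phi_self (silver_sum_nonneg i)]
    generalize gdIter g (x - α • g x) (silver i) = y at *
    have hstep : 1 + (√2 - 1) * (1 + √2) ^ i ≤ 1 + (√2 - 1) * ((silver i).sum + 1) := by
      rw [hsum]
      linarith
    have hN := sq_nonneg ‖g y‖
    rcases (Nat.one_le_iff_ne_zero.2 hi).eq_or_lt with rfl | hi2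
    · obtain rfl : k = 0 := by simpa [silver_length] using hk
      have h := sub_le_of_step hfg y (α := 1 + (√2 - 1) * ((silver 1).sum + 1)) (by nlinarith)
      have hA1 : (silver 1).sum = √2 := by simp [hsum]
      have hβ : 1 + (√2 - 1) * ((silver 1).sum + 1) = 2 := by
        rw [hA1]
        linear_combination hs2
      rw [hβ] at h ⊢
      simp only [List.take_zero, gdIter]
      rw [hA1] at hf hg
      have hf' : f y - f x ≤ 0.4 * (α ^ 2 * ‖g x‖ ^ 2) := by nlinarith
      have hg' : ‖g y‖ ^ 2 ≤ 0.6 * (α ^ 2 * ‖g x‖ ^ 2) := by nlinarith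
      linarith
    · have h := ih y hstep k (Or.inr hk)
      have ha2 : 5.8 ≤ (silver i).sum + 1 := by
        have := pow_le_pow_right₀ (show 1 ≤ 1 + √2 by linarith) hi2
        rw [hsum]
        nlinarith
      generalize (silver i).sum = A at *
      have hf' : f y - f x ≤ 0.2 * (α ^ 2 * ‖g x‖ ^ 2) := by nlinarith
      have hβ : (1 + (√2 - 1) * (A + 1)) ^ 2 ≤ (1 + 0.41422 * (A + 1)) ^ 2 := by
        refine pow_le_pow_left₀ (by nlinarith) ?_ 2
        nlinarith
      have hβ' : 2 * (1 + (√2 - 1) * (A + 1)) ^ 2 ≤ 0.9 * (A * (A + 1)) := by nlinarith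
      have := mul_le_mul_of_nonneg_right hβ' hN
      linarith

end SmoothConvex

/-- intermediate-value control along the `i`-th silver schedule,
started from `x₁ = x₀ − α·g₀` with `α ≥ (√2−1)A_k + √2`. -/
theorem silver_intermediate_value_bound (i : ℕ) (hi : 1 ≤ i)
    (d : ℕ) (f : EuclideanSpace ℝ (Fin d) → ℝ)
    (g : EuclideanSpace ℝ (Fin d) → EuclideanSpace ℝ (Fin d))
    (hconv : ConvexOn ℝ Set.univ f)
    (hgrad : ∀ y, HasGradientAt f (g y) y)
    (hlip : LipschitzWith 1 g)
    (hmin : ∃ xstar, IsMinOn f Set.univ xstar)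
    (x0 : EuclideanSpace ℝ (Fin d)) (α : ℝ)
    (hα : (Real.sqrt 2 - 1) * (silver i).sum + Real.sqrt 2 ≤ α) :
    ∀ l : ℕ, 1 ≤ l → l ≤ 2 ^ i - 1 →
      f (gdIter g (x0 - α • g x0) ((silver i).take (l - 1))) - f x0 ≤
        432 * α ^ 2 * ‖g x0‖ ^ 2 := by
  intro l hl1 hl
  refine (gdIter_silver_sub_le (interpolates_of_convexOn hconv hgrad hlip) i x0 (α := α) ?_ (l - 1)
    ?_).trans ?_
  · rw [silver_sum] at hα
    linarith
  · rw [silver_length]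
    omega
  · have : 0 ≤ α ^ 2 * ‖g x0‖ ^ 2 := by positivity
    linarith
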